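/- Let d ≥ 0, n > d, and let T = {T_1,…,T_l} ∈ L(n,d) with l ≥ 1. Then μ_{n,d}(T) = ∏_{i=1}^l μ_{n−|T_i|, d−|T_i|}(⊤_i), where ⊤_i denotes the maximum element {∅} of the poset L(n − |T_i|, d − |T_i|). (In particular, when |T_i| = d the corresponding factor is the Möbius value of the maximum of the two-element poset L(n−d, 0), which equals −1.) -/

import Mathlib

attribute [local instance] Classical.propDecidable

/-- Collections of subsets of `{1,…,n}` (modelled as `Fin n`). -/
abbrev Coll (n : ℕ) := Finset (Finset (Fin n))

/-- `codim_d X = d + 1 - |X|`. -/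
def codim {n : ℕ} (d : ℕ) (X : Finset (Fin n)) : ℤ := (d : ℤ) + 1 - X.card

/-- `ρ_d T = Σ_{X ∈ T} codim_d X`. -/
def rho {n : ℕ} (d : ℕ) (T : Coll n) : ℤ := ∑ X ∈ T, codim d X

/-- `D_d T = codim_d (T_1 ∩ … ∩ T_l) - ρ_d T` (used when `|T| ≥ 2`). -/
def Dd {n : ℕ} (d : ℕ) (T : Coll n) : ℤ := codim d (T.inf id) - rho d T

/-- Membership in the lattice `L(n,d)`. -/
def memL (n d : ℕ) (T : Coll n) : Prop :=
  (∀ T' ⊆ T, 2 ≤ T'.card → 0 < Dd d T') ∧ ∀ X ∈ T, X.card ≤ d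

/-- The intersection lattice `L(n,d)`. -/
structure L (n d : ℕ) where
  val : Coll n
  mem : memL n d val

namespace L

instance (n d : ℕ) : PartialOrder (L n d) where
  le S T := S = T ∨ (rho d S.val < rho d T.val ∧ ∀ X ∈ S.val, ∃ Y ∈ T.val, Y ⊆ X)
  le_refl S := Or.inl rfl
  le_trans S T U hST hTU := by
    rcases hST with rfl | hST
    · exact hTU
    · rcases hTU with rfl | hTU
      · exact Or.inr hST
      · refine Or.inr ⟨hST.1.trans hTU.1, fun X hX => ?_⟩
        obtain ⟨Y, hY, hYX⟩ := hST.2 X hX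
        obtain ⟨Z, hZ, hZY⟩ := hTU.2 Y hY
        exact ⟨Z, hZ, hZY.trans hYX⟩
  le_antisymm S T hST hTS := by
    rcases hST with rfl | hST
    · rfl
    · rcases hTS with rfl | hTS
      · rfl
      · exact absurd (hST.1.trans hTS.1) (lt_irrefl _)

noncomputable instance (n d : ℕ) : Fintype (L n d) :=
  Fintype.ofInjective (fun T : L n d => T.val)
    (fun a b h => by cases a; cases b; simpa using h)

end L

/-- The minimum element `∅` of `L(n,d)`. -/
def Lbot (n d : ℕ) : L n d :=
  ⟨∅, by
    constructor
    · intro T' hT' h2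
      rw [Finset.subset_empty] at hT'
      subst hT'
      simp at h2
    · intro X hX
      simp at hX⟩

/-- The maximum element `{∅}` of `L(n,d)`. -/
def Ltop (n d : ℕ) : L n d :=
  ⟨{∅}, by
    constructor
    · intro T' hT' h2
      have h1 : T'.card ≤ 1 := (Finset.card_le_card hT').trans_eq (Finset.card_singleton _)
      exact absurd h2 (by omega)
    · intro X hX
      rw [Finset.mem_singleton] at hX
      subst hX
      simp⟩

/-- The singleton collection `{X}` as an element of `L(n,d)`. -/
def singL (n d : ℕ) (X : Finset (Fin n)) (hX : X.card ≤ d) : L n d :=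
  ⟨{X}, by
    constructor
    · intro T' hT' h2
      have h1 : T'.card ≤ 1 := (Finset.card_le_card hT').trans_eq (Finset.card_singleton _)
      exact absurd h2 (by omega)
    · intro Y hY
      rw [Finset.mem_singleton] at hY
      subst hY
      exact hX⟩

/-- The type of `T ∈ L(n,d)`: the multiset of codimensions of its members. -/
def typeOf {n : ℕ} (d : ℕ) (T : L n d) : Multiset ℕ :=
  T.val.val.map (fun X => d + 1 - X.card)

/-- `λ_{n,d}(γ)`: the number of elements of `L(n,d)` of type `γ`. -/
noncomputable def lam (n d : ℕ) (γ : Multiset ℕ) : ℕ :=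
  (Finset.univ.filter (fun T : L n d => typeOf d T = γ)).card

/-- `κ_{n,d}(m,T)`: the number of `m`-element sets of `d`-element subsets of `{1,…,n}`
whose corresponding hyperplanes have least upper bound `T` in `L(n,d)`. -/
noncomputable def kappa (n d m : ℕ) (T : L n d) : ℕ :=
  (Finset.univ.filter (fun H : Coll n =>
      H.card = m ∧ (∀ X ∈ H, X.card = d) ∧
      IsLUB {S : L n d | ∃ X ∈ H, S.val = {X}} T)).card

theorem codim_anti {n : ℕ} (d : ℕ) {X Y : Finset (Fin n)} (h : Y ⊆ X) : codim d X ≤ codim d Y := by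
  have := Finset.card_le_card h
  unfold codim
  omega

theorem memL.mono {n d : ℕ} {S T : Coll n} (hT : memL n d T) (h : S ⊆ T) : memL n d S :=
  ⟨fun T' hT' => hT.1 T' (hT'.trans h), fun X hX => hT.2 X (h hX)⟩

/-- Members of an element of `L(n,d)` contained in a common set of size at most `d` coincide. -/
theorem memL.eq_of_subset {n d : ℕ} {T : Coll n} (hT : memL n d T) {X Y Z : Finset (Fin n)}
    (hX : X.card ≤ d) (hY : Y ∈ T) (hZ : Z ∈ T) (hYX : Y ⊆ X) (hZX : Z ⊆ X) : Y = Z := by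
  by_contra hne
  have h := hT.1 {Y, Z} (by
    intro W hW
    simp only [Finset.mem_insert, Finset.mem_singleton] at hW
    rcases hW with rfl | rfl <;> assumption) (by rw [Finset.card_pair hne])
  have hc := Finset.card_union_add_card_inter Y Z
  have hu := Finset.card_le_card (Finset.union_subset hYX hZX)
  simp only [Dd, rho, codim, Finset.sum_pair hne, Finset.inf_insert, Finset.inf_singleton, id,
    Finset.inf_eq_inter] at h
  omega

theorem memL.rho_le_codim_inf {n d : ℕ} {T : Coll n} (hT : memL n d T) (hne : T.Nonempty) :
    rho d T ≤ codim d (T.inf id) := by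
  by_cases h2 : 2 ≤ T.card
  · have := hT.1 T subset_rfl h2
    unfold Dd at this
    omega
  · obtain ⟨X, rfl⟩ := Finset.card_eq_one.1 (show T.card = 1 by have := hne.card_pos; omega)
    simp [rho]

theorem memL.rho_le_codim {n d : ℕ} {T : Coll n} (hT : memL n d T) {Y : Finset (Fin n)}
    (hY : Y.card ≤ d) (h : ∀ X ∈ T, Y ⊆ X) : rho d T ≤ codim d Y := by
  rcases T.eq_empty_or_nonempty with rfl | hne
  · simp only [rho, Finset.sum_empty, codim]
    omega
  · exact (hT.rho_le_codim_inf hne).trans (codim_anti d (Finset.le_inf h))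

theorem memL.eq_singleton_of_rho_eq {n d : ℕ} {T : Coll n} (hT : memL n d T)
    {Y : Finset (Fin n)} (hY : Y.card ≤ d) (h : ∀ X ∈ T, Y ⊆ X) (heq : rho d T = codim d Y) :
    T = {Y} := by
  have hpos : 0 < codim d Y := by
    unfold codim
    omega
  by_cases h2 : 2 ≤ T.card
  · have h3 := hT.1 T subset_rfl h2
    have h4 := codim_anti d (show Y ⊆ T.inf id from Finset.le_inf h)
    unfold Dd at h3
    omega
  · have hne : T.Nonempty := by
      rw [Finset.nonempty_iff_ne_empty]
      rintro rfl
      simp only [rho, Finset.sum_empty] at heq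
      omega
    obtain ⟨X, rfl⟩ := Finset.card_eq_one.1 (show T.card = 1 by have := hne.card_pos; omega)
    have hYX := h X (Finset.mem_singleton_self X)
    simp only [rho, Finset.sum_singleton, codim] at heq
    rw [Finset.eq_of_subset_of_card_le hYX (by omega)]

theorem memL.pairwiseDisjoint_filter {n d : ℕ} {S T : Coll n} (hT : memL n d T)
    (hS : ∀ X ∈ S, X.card ≤ d) :
    (T : Set (Finset (Fin n))).PairwiseDisjoint (fun Y => S.filter (fun X => Y ⊆ X)) := by
  intro Y hY Z hZ hne
  rw [Function.onFun, Finset.disjoint_left]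
  intro X h1 h2
  rw [Finset.mem_filter] at h1 h2
  exact hne (hT.eq_of_subset (hS X h1.1) hY hZ h1.2 h2.2)

theorem biUnion_filter_superset {n : ℕ} {S T : Coll n} (h : ∀ X ∈ S, ∃ Y ∈ T, Y ⊆ X) :
    T.biUnion (fun Y => S.filter (fun X => Y ⊆ X)) = S := by
  ext X
  simp only [Finset.mem_biUnion, Finset.mem_filter]
  constructor
  · rintro ⟨Y, -, hX, -⟩
    exact hX
  · intro hX
    obtain ⟨Y, hY, hYX⟩ := h X hX
    exact ⟨Y, hY, hX, hYX⟩

theorem memL.rho_eq_sum_filter {n d : ℕ} {S T : Coll n} (hT : memL n d T)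
    (hS : ∀ X ∈ S, X.card ≤ d) (h : ∀ X ∈ S, ∃ Y ∈ T, Y ⊆ X) :
    rho d S = ∑ Y ∈ T, rho d (S.filter (fun X => Y ⊆ X)) := by
  conv_lhs => rw [← biUnion_filter_superset h]
  exact Finset.sum_biUnion (hT.pairwiseDisjoint_filter hS)

theorem L.val_injective {n d : ℕ} : Function.Injective (L.val : L n d → Coll n) := by
  rintro ⟨a, _⟩ ⟨b, _⟩ rfl
  rfl

/-- The order on `L(n,d)` is refinement; the rank condition is automatic. -/
theorem L.le_iff {n d : ℕ} {S T : L n d} :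
    S ≤ T ↔ ∀ X ∈ S.val, ∃ Y ∈ T.val, Y ⊆ X := by
  constructor
  · rintro (rfl | h)
    · exact fun X hX => ⟨X, hX, subset_rfl⟩
    · exact h.2
  · intro h
    by_cases hST : S = T
    · exact Or.inl hST
    refine Or.inr ⟨?_, h⟩
    by_contra! hle
    have hpiece : ∀ Y ∈ T.val, rho d (S.val.filter (fun X => Y ⊆ X)) ≤ codim d Y := fun Y hY =>
      (S.mem.mono (Finset.filter_subset _ _)).rho_le_codim (T.mem.2 Y hY)
        (fun X hX => (Finset.mem_filter.1 hX).2)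
    rw [T.mem.rho_eq_sum_filter S.mem.2 h] at hle
    have heq := (Finset.sum_eq_sum_iff_of_le hpiece).1
      (le_antisymm (Finset.sum_le_sum hpiece) hle)
    apply hST
    apply L.val_injective
    rw [← biUnion_filter_superset h]
    calc _ = T.val.biUnion (fun Y => {Y}) := Finset.biUnion_congr rfl fun Y hY =>
          (S.mem.mono (Finset.filter_subset _ _)).eq_singleton_of_rho_eq (T.mem.2 Y hY)
            (fun X hX => (Finset.mem_filter.1 hX).2) (heq Y hY)
      _ = T.val := Finset.biUnion_singleton_eq_self

theorem L.bot_le {n d : ℕ} (S : L n d) : Lbot n d ≤ S :=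
  L.le_iff.2 fun X hX => absurd hX (Finset.notMem_empty X)

theorem card_inf_add_sum_le {n : ℕ} (A : Coll n) (Z : Finset (Fin n) → Finset (Fin n))
    (hZ : ∀ Y ∈ A, Y ⊆ Z Y) :
    ((A.inf Z).card : ℤ) + ∑ Y ∈ A, (Y.card : ℤ) ≤
      ((A.inf id).card : ℤ) + ∑ Y ∈ A, ((Z Y).card : ℤ) := by
  have hsub : A.inf Z ⊆ A.inf id ∪ A.biUnion (fun Y => Z Y \ Y) := by
    intro x hx
    simp only [Finset.mem_union, Finset.mem_inf, Finset.mem_biUnion, Finset.mem_sdiff, id] at hx ⊢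
    by_contra! hcon
    obtain ⟨⟨Y, hY, hxY⟩, h2⟩ := hcon
    exact hxY (h2 Y hY (hx Y hY))
  have h1 := Finset.card_le_card hsub
  have h2 := Finset.card_union_le (A.inf id) (A.biUnion (fun Y => Z Y \ Y))
  have h3 : (A.biUnion (fun Y => Z Y \ Y)).card ≤ ∑ Y ∈ A, (Z Y \ Y).card :=
    Finset.card_biUnion_le
  have h4 : ∑ Y ∈ A, (Z Y \ Y).card + ∑ Y ∈ A, Y.card = ∑ Y ∈ A, (Z Y).card := by
    rw [← Finset.sum_add_distrib]
    exact Finset.sum_congr rfl fun Y hY => Finset.card_sdiff_add_card_eq_card (hZ Y hY)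
  exact_mod_cast (show (A.inf Z).card + ∑ Y ∈ A, Y.card ≤
    (A.inf id).card + ∑ Y ∈ A, (Z Y).card by omega)

/-- Refining each member of an element of `L(n,d)` separately stays in `L(n,d)`. -/
theorem memL.biUnion {n d : ℕ} {T : Coll n} (hT : memL n d T) {S : Finset (Fin n) → Coll n}
    (hS : ∀ Y ∈ T, memL n d (S Y)) (hsub : ∀ Y ∈ T, ∀ X ∈ S Y, Y ⊆ X) :
    memL n d (T.biUnion S) := by
  have hcard : ∀ X ∈ T.biUnion S, X.card ≤ d := by
    intro X hX
    obtain ⟨Y, hY, hXY⟩ := Finset.mem_biUnion.1 hX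
    exact (hS Y hY).2 X hXY
  refine ⟨fun T' hT' h2 => ?_, hcard⟩
  set P : Finset (Fin n) → Coll n := fun Y => T'.filter (fun X => Y ⊆ X) with hP
  have hPS : ∀ Y ∈ T, P Y ⊆ S Y := by
    intro Y hY X hX
    obtain ⟨hX1, hX2⟩ := Finset.mem_filter.1 hX
    obtain ⟨Y', hY', hXY'⟩ := Finset.mem_biUnion.1 (hT' hX1)
    rwa [hT.eq_of_subset (hcard X (hT' hX1)) hY hY' hX2 (hsub Y' hY' X hXY')]
  set A : Coll n := T.filter (fun Y => (P Y).Nonempty) with hA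
  have hAT : A ⊆ T := Finset.filter_subset _ _
  have hcov : ∀ X ∈ T', ∃ Y ∈ A, Y ⊆ X := by
    intro X hX
    obtain ⟨Y, hY, hXY⟩ := Finset.mem_biUnion.1 (hT' hX)
    have hYX := hsub Y hY X hXY
    exact ⟨Y, Finset.mem_filter.2 ⟨hY, X, Finset.mem_filter.2 ⟨hX, hYX⟩⟩, hYX⟩
  have hAL : memL n d A := hT.mono hAT
  have hT'A : A.biUnion P = T' := biUnion_filter_superset hcov
  by_cases hA2 : 2 ≤ A.card
  · have hD := hAL.1 A subset_rfl hA2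
    have hrho : rho d T' ≤ ∑ Y ∈ A, codim d ((P Y).inf id) := by
      rw [hAL.rho_eq_sum_filter (fun X hX => hcard X (hT' hX)) hcov]
      exact Finset.sum_le_sum fun Y hY => ((hS Y (hAT hY)).mono (hPS Y (hAT hY))).rho_le_codim_inf
        (Finset.mem_filter.1 hY).2
    have hinf : T'.inf id = A.inf (fun Y => (P Y).inf id) := by
      rw [← hT'A, Finset.inf_biUnion]
    have hc := card_inf_add_sum_le A (fun Y => (P Y).inf id)
      (fun Y _ => Finset.le_inf fun X hX => (Finset.mem_filter.1 hX).2)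
    rw [← hinf] at hc
    simp only [Dd, codim, rho, Finset.sum_sub_distrib] at hD hrho ⊢
    linarith
  · have hA1 : A.card = 1 := by
      have hne : A.Nonempty := by
        obtain ⟨X, hX⟩ := Finset.card_pos.1 (show 0 < T'.card by omega)
        obtain ⟨Y, hY, -⟩ := hcov X hX
        exact ⟨Y, hY⟩
      have := hne.card_pos
      omega
    obtain ⟨Y, hY⟩ := Finset.card_eq_one.1 hA1
    have hYT : Y ∈ T := hAT (hY ▸ Finset.mem_singleton_self Y)
    rw [hY, Finset.singleton_biUnion] at hT'A
    exact (hS Y hYT).1 T' (hT'A ▸ hPS Y hYT) h2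

/-- The elements of `L(n,d)` refining `T`, as collections. -/
noncomputable def lowerColl (n d : ℕ) (T : Coll n) : Finset (Coll n) :=
  Finset.univ.filter (fun C => memL n d C ∧ ∀ X ∈ C, ∃ Y ∈ T, Y ⊆ X)

theorem mem_lowerColl {n d : ℕ} {T C : Coll n} :
    C ∈ lowerColl n d T ↔ memL n d C ∧ ∀ X ∈ C, ∃ Y ∈ T, Y ⊆ X := by
  simp [lowerColl]

theorem sum_Iic_eq_sum_lowerColl {n d : ℕ} (T : L n d) (f : Coll n → ℤ) :
    ∑ S ∈ Finset.univ.filter (fun S : L n d => Lbot n d ≤ S ∧ S ≤ T), f S.val =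
      ∑ C ∈ lowerColl n d T.val, f C := by
  refine Finset.sum_bij (fun S _ => S.val) ?_ (fun _ _ _ _ h => L.val_injective h) ?_
    (fun _ _ => rfl)
  · intro S hS
    exact mem_lowerColl.2 ⟨S.mem, L.le_iff.1 (Finset.mem_filter.1 hS).2.2⟩
  · intro C hC
    obtain ⟨h1, h2⟩ := mem_lowerColl.1 hC
    exact ⟨⟨C, h1⟩, Finset.mem_filter.2 ⟨Finset.mem_univ _, L.bot_le _, L.le_iff.2 h2⟩, rfl⟩

/-- The lower interval of `T` factors as the product of the lower intervals of its members. -/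
theorem sum_lowerColl_prod {n d : ℕ} {T : Coll n} (hT : memL n d T) (m : Finset (Fin n) → ℤ) :
    ∑ C ∈ lowerColl n d T, ∏ X ∈ C, m X =
      ∏ Y ∈ T, ∑ C ∈ lowerColl n d {Y}, ∏ X ∈ C, m X := by
  rw [Finset.prod_sum]
  refine Finset.sum_bij' (fun C _ Y _ => C.filter (fun X => Y ⊆ X))
    (fun p _ => T.biUnion (fun Y => if h : Y ∈ T then p Y h else ∅)) ?_ ?_ ?_ ?_ ?_
  · intro C hC
    obtain ⟨h1, -⟩ := mem_lowerColl.1 hC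
    rw [Finset.mem_pi]
    intro Y _
    exact mem_lowerColl.2 ⟨h1.mono (Finset.filter_subset _ _),
      fun X hX => ⟨Y, Finset.mem_singleton_self Y, (Finset.mem_filter.1 hX).2⟩⟩
  · intro p hp
    rw [Finset.mem_pi] at hp
    have hsub : ∀ Y (h : Y ∈ T), ∀ X ∈ p Y h, Y ⊆ X := by
      intro Y hY X hX
      obtain ⟨Z, hZ, hZX⟩ := (mem_lowerColl.1 (hp Y hY)).2 X hX
      rwa [Finset.mem_singleton.1 hZ] at hZX
    refine mem_lowerColl.2 ⟨hT.biUnion ?_ ?_, ?_⟩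
    · intro Y hY
      rw [dif_pos hY]
      exact (mem_lowerColl.1 (hp Y hY)).1
    · intro Y hY
      rw [dif_pos hY]
      exact hsub Y hY
    · intro X hX
      obtain ⟨Y, hY, hXY⟩ := Finset.mem_biUnion.1 hX
      rw [dif_pos hY] at hXY
      exact ⟨Y, hY, hsub Y hY X hXY⟩
  · intro C hC
    obtain ⟨-, h2⟩ := mem_lowerColl.1 hC
    conv_rhs => rw [← biUnion_filter_superset h2]
    exact Finset.biUnion_congr rfl fun Y hY => dif_pos hY
  · intro p hp
    rw [Finset.mem_pi] at hp
    have hmem : ∀ Y (h : Y ∈ T), ∀ X ∈ p Y h, Y ⊆ X ∧ X.card ≤ d := by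
      intro Y hY X hX
      obtain ⟨h1, h2⟩ := mem_lowerColl.1 (hp Y hY)
      obtain ⟨Z, hZ, hZX⟩ := h2 X hX
      rw [Finset.mem_singleton.1 hZ] at hZX
      exact ⟨hZX, h1.2 X hX⟩
    funext Y hY
    ext X
    simp only [Finset.mem_filter, Finset.mem_biUnion]
    constructor
    · rintro ⟨⟨Z, hZ, hXZ⟩, hYX⟩
      rw [dif_pos hZ] at hXZ
      obtain ⟨hZX, hc⟩ := hmem Z hZ X hXZ
      obtain rfl := hT.eq_of_subset hc hY hZ hYX hZX
      exact hXZ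
    · intro hX
      exact ⟨⟨Y, hY, by rwa [dif_pos hY]⟩, (hmem Y hY X hX).1⟩
  · intro C hC
    obtain ⟨h1, h2⟩ := mem_lowerColl.1 hC
    rw [Finset.prod_attach T (fun Y => ∏ X ∈ C.filter (fun X => Y ⊆ X), m X),
      ← Finset.prod_biUnion (hT.pairwiseDisjoint_filter h1.2), biUnion_filter_superset h2]

/-- Two functions with equal sums over the lower interval of `T` that agree strictly below `T`
agree at `T`. -/
theorem eq_of_sum_Iic_eq {n d : ℕ} {T : L n d} {f g : L n d → ℤ}
    (hsum : ∑ S ∈ Finset.univ.filter (fun S : L n d => Lbot n d ≤ S ∧ S ≤ T), f S =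
      ∑ S ∈ Finset.univ.filter (fun S : L n d => Lbot n d ≤ S ∧ S ≤ T), g S)
    (hlt : ∀ S < T, f S = g S) : f T = g T := by
  have hmem : T ∈ Finset.univ.filter (fun S : L n d => Lbot n d ≤ S ∧ S ≤ T) :=
    Finset.mem_filter.2 ⟨Finset.mem_univ _, L.bot_le T, le_rfl⟩
  rw [← Finset.add_sum_erase _ _ hmem, ← Finset.add_sum_erase _ g hmem] at hsum
  rw [Finset.sum_congr rfl fun S hS => hlt S (lt_of_le_of_ne
    (Finset.mem_filter.1 (Finset.mem_of_mem_erase hS)).2.2 (Finset.ne_of_mem_erase hS))] at hsum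
  exact add_right_cancel hsum

/-- The Möbius function of `L(n,d)` is multiplicative over the members of a collection. -/
theorem mobius_eq_prod_singL {n d : ℕ} (μ : L n d → L n d → ℤ) (hrefl : ∀ A, μ A A = 1)
    (hrec : ∀ A B : L n d, A < B →
      ∑ S ∈ Finset.univ.filter (fun S : L n d => A ≤ S ∧ S ≤ B), μ A S = 0)
    (m : Finset (Fin n) → ℤ)
    (hm : ∀ X (hX : X.card ≤ d), m X = μ (Lbot n d) (singL n d X hX)) (T : L n d) :
    μ (Lbot n d) T = ∏ X ∈ T.val, m X := by
  induction T using WellFoundedLT.induction with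
  | ind T ih =>
    rcases T.val.eq_empty_or_nonempty with h0 | hne
    · obtain rfl : T = Lbot n d := L.val_injective h0
      rw [hrefl, h0, Finset.prod_empty]
    by_cases h2 : 2 ≤ T.val.card
    · refine eq_of_sum_Iic_eq (g := fun S => ∏ X ∈ S.val, m X) ?_ ih
      have hbot : Lbot n d < T := lt_of_le_of_ne (L.bot_le T) (by
        rintro rfl
        exact Finset.not_nonempty_empty hne)
      rw [hrec _ _ hbot, sum_Iic_eq_sum_lowerColl T (fun C => ∏ X ∈ C, m X),
        sum_lowerColl_prod T.mem]
      obtain ⟨Y, hY⟩ := hne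
      refine (Finset.prod_eq_zero hY ?_).symm
      have hYd := T.mem.2 Y hY
      have hYT : singL n d Y hYd < T := by
        refine lt_of_le_of_ne (L.le_iff.2 fun X hX => ⟨Y, hY, ?_⟩) ?_
        · rw [Finset.mem_singleton.1 hX]
        · rintro rfl
          exact absurd h2 (by simp [singL])
      have hbY : Lbot n d < singL n d Y hYd := lt_of_le_of_ne (L.bot_le _) fun h =>
        Finset.singleton_ne_empty Y (congrArg L.val h).symm
      rw [← hrec _ _ hbY]
      refine (sum_Iic_eq_sum_lowerColl (singL n d Y hYd) (fun C => ∏ X ∈ C, m X)).symm.trans ?_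
      exact Finset.sum_congr rfl fun S hS =>
        (ih S ((Finset.mem_filter.1 hS).2.2.trans_lt hYT)).symm
    · obtain ⟨X, hX⟩ := Finset.card_eq_one.1
        (show T.val.card = 1 by have := hne.card_pos; omega)
      have hXd : X.card ≤ d := T.mem.2 X (hX ▸ Finset.mem_singleton_self X)
      obtain rfl : T = singL n d X hXd := L.val_injective hX
      rw [hX, Finset.prod_singleton, hm X hXd]

/-- The Möbius function is preserved by an order embedding of `L(n',d')` onto a lower set. -/
theorem mobius_map_eq {n d n' d' : ℕ} (μ : L n d → L n d → ℤ) (μ' : L n' d' → L n' d' → ℤ)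
    (hrefl : ∀ A, μ A A = 1) (hrefl' : ∀ A, μ' A A = 1)
    (hrec : ∀ A B : L n d, A < B →
      ∑ S ∈ Finset.univ.filter (fun S : L n d => A ≤ S ∧ S ≤ B), μ A S = 0)
    (hrec' : ∀ A B : L n' d', A < B →
      ∑ S ∈ Finset.univ.filter (fun S : L n' d' => A ≤ S ∧ S ≤ B), μ' A S = 0)
    (φ : L n' d' ↪o L n d) (hφ : IsLowerSet (Set.range φ)) (T : L n' d') :
    μ (Lbot n d) (φ T) = μ' (Lbot n' d') T := by
  have hbot : φ (Lbot n' d') = Lbot n d := by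
    obtain ⟨S, hS⟩ := hφ (L.bot_le (φ (Lbot n' d'))) ⟨_, rfl⟩
    refine le_antisymm ?_ (L.bot_le _)
    rw [← hS]
    exact φ.monotone (L.bot_le S)
  induction T using WellFoundedLT.induction with
  | ind T ih =>
    rcases (L.bot_le T).eq_or_lt with rfl | hlt
    · rw [hbot, hrefl, hrefl']
    refine eq_of_sum_Iic_eq (f := fun S => μ (Lbot n d) (φ S)) ?_ ih
    have hlt' : Lbot n d < φ T := by
      rw [← hbot]
      exact φ.strictMono hlt
    rw [hrec' _ _ hlt, ← hrec _ _ hlt']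
    refine Finset.sum_bij (fun S _ => φ S) ?_ (fun _ _ _ _ h => φ.injective h) ?_ (fun _ _ => rfl)
    · intro S hS
      exact Finset.mem_filter.2 ⟨Finset.mem_univ _, L.bot_le _,
        φ.monotone (Finset.mem_filter.1 hS).2.2⟩
    · intro S hS
      obtain ⟨-, -, hST⟩ := Finset.mem_filter.1 hS
      obtain ⟨R, rfl⟩ := hφ hST ⟨_, rfl⟩
      exact ⟨R, Finset.mem_filter.2 ⟨Finset.mem_univ _, L.bot_le _, φ.le_iff_le.1 hST⟩, rfl⟩

/-- Adjoining a set `X` to the image of a subset of `Fin m`. -/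
def joinMap {n m : ℕ} (X : Finset (Fin n)) (e : Fin m ↪ Fin n) (Z : Finset (Fin m)) :
    Finset (Fin n) :=
  X ∪ Z.map e

section JoinMap

variable {n m : ℕ} {X : Finset (Fin n)} {e : Fin m ↪ Fin n}

theorem disjoint_map_of_forall_notMem (he : ∀ i, e i ∉ X) (Z : Finset (Fin m)) :
    Disjoint X (Z.map e) := by
  rw [Finset.disjoint_right]
  intro x hx
  obtain ⟨i, -, rfl⟩ := Finset.mem_map.1 hx
  exact he i

theorem joinMap_subset_joinMap (he : ∀ i, e i ∉ X) {Y Z : Finset (Fin m)} :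
    joinMap X e Y ⊆ joinMap X e Z ↔ Y ⊆ Z := by
  constructor
  · intro h i hi
    have := h (Finset.mem_union_right X (Finset.mem_map_of_mem e hi))
    rcases Finset.mem_union.1 this with h1 | h1
    · exact absurd h1 (he i)
    · exact (Finset.mem_map' e).1 h1
  · intro h
    exact Finset.union_subset_union subset_rfl (Finset.map_subset_map.2 h)

theorem joinMap_injective (he : ∀ i, e i ∉ X) : Function.Injective (joinMap X e) := fun _ _ h =>
  ((joinMap_subset_joinMap he).1 h.subset).antisymm ((joinMap_subset_joinMap he).1 h.superset)

theorem card_joinMap (he : ∀ i, e i ∉ X) (Z : Finset (Fin m)) :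
    (joinMap X e Z).card = X.card + Z.card := by
  rw [joinMap, Finset.card_union_of_disjoint (disjoint_map_of_forall_notMem he Z),
    Finset.card_map]

theorem exists_joinMap_eq (he : ∀ x, x ∉ X → x ∈ Set.range e) {W : Finset (Fin n)} (h : X ⊆ W) :
    ∃ Z, joinMap X e Z = W := by
  refine ⟨Finset.univ.filter (fun i => e i ∈ W), ?_⟩
  ext x
  simp only [joinMap, Finset.mem_union, Finset.mem_map, Finset.mem_filter, Finset.mem_univ,
    true_and]
  constructor
  · rintro (hx | ⟨i, hi, rfl⟩)
    · exact h hx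
    · exact hi
  · intro hx
    by_cases hxX : x ∈ X
    · exact Or.inl hxX
    · obtain ⟨i, rfl⟩ := he x hxX
      exact Or.inr ⟨i, hx, rfl⟩

theorem inf_image_joinMap {C : Coll m} (hC : C.Nonempty) :
    (C.image (joinMap X e)).inf id = joinMap X e (C.inf id) := by
  rw [Finset.inf_image]
  ext x
  simp only [Finset.mem_inf, Function.comp_apply, id, joinMap, Finset.mem_union, Finset.mem_map]
  constructor
  · intro h
    by_cases hx : x ∈ X
    · exact Or.inl hx
    obtain ⟨Y, hY⟩ := hC
    obtain ⟨i, -, rfl⟩ := (h Y hY).resolve_left hx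
    refine Or.inr ⟨i, fun Z hZ => ?_, rfl⟩
    obtain ⟨j, hj, hji⟩ := (h Z hZ).resolve_left hx
    rwa [← e.injective hji]
  · rintro (hx | ⟨i, hi, rfl⟩) Z hZ
    · exact Or.inl hx
    · exact Or.inr ⟨i, hi Z hZ, rfl⟩

variable {d d' : ℕ}

theorem codim_joinMap (he : ∀ i, e i ∉ X) (hd : d' + X.card = d) (Z : Finset (Fin m)) :
    codim d (joinMap X e Z) = codim d' Z := by
  rw [codim, codim, card_joinMap he]
  omega

theorem Dd_image_joinMap (he : ∀ i, e i ∉ X) (hd : d' + X.card = d) {C : Coll m}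
    (hC : C.Nonempty) : Dd d (C.image (joinMap X e)) = Dd d' C := by
  rw [Dd, Dd, inf_image_joinMap hC, codim_joinMap he hd, rho, rho,
    Finset.sum_image (joinMap_injective he).injOn]
  simp only [codim_joinMap he hd]

theorem memL_image_joinMap (he : ∀ i, e i ∉ X) (hd : d' + X.card = d) {C : Coll m} :
    memL n d (C.image (joinMap X e)) ↔ memL m d' C := by
  refine and_congr ?_ ?_
  · constructor
    · intro h C' hC' h2
      have hne : C'.Nonempty := Finset.card_pos.1 (by omega)
      rw [← Dd_image_joinMap he hd hne]
      exact h _ (Finset.image_subset_image hC')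
        (by rwa [Finset.card_image_of_injective _ (joinMap_injective he)])
    · intro h T' hT' h2
      obtain ⟨C', hC', rfl⟩ := Finset.subset_image_iff.1 hT'
      rw [Finset.card_image_of_injective _ (joinMap_injective he)] at h2
      rw [Dd_image_joinMap he hd (Finset.card_pos.1 (by omega))]
      exact h C' (by exact_mod_cast hC') h2
  · simp only [Finset.forall_mem_image, card_joinMap he]
    exact forall₂_congr fun Z _ => by omega

/-- The embedding of `L(m,d')` into `L(n,d)` given by adjoining a set `X` to every member. -/
noncomputable def joinEmb (he : ∀ i, e i ∉ X) (hd : d' + X.card = d) : L m d' ↪o L n d :=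
  OrderEmbedding.ofMapLEIff
    (fun S => ⟨S.val.image (joinMap X e), (memL_image_joinMap he hd).2 S.mem⟩) fun S T => by
      simp only [L.le_iff, Finset.forall_mem_image, Finset.exists_mem_image,
        joinMap_subset_joinMap he]

theorem val_joinEmb (he : ∀ i, e i ∉ X) (hd : d' + X.card = d) (S : L m d') :
    (joinEmb he hd S).val = S.val.image (joinMap X e) :=
  rfl

theorem isLowerSet_range_joinEmb (he : ∀ i, e i ∉ X) (he' : ∀ x, x ∉ X → x ∈ Set.range e)
    (hd : d' + X.card = d) : IsLowerSet (Set.range (joinEmb (m := m) he hd)) := by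
  rintro _ S hle ⟨T, rfl⟩
  have hmem : S.val ⊆ Finset.univ.image (joinMap X e) := by
    intro W hW
    obtain ⟨Y, hY, hYW⟩ := L.le_iff.1 hle W hW
    obtain ⟨Z, -, rfl⟩ := Finset.mem_image.1 hY
    obtain ⟨V, hV⟩ := exists_joinMap_eq he' (Finset.subset_union_left.trans hYW)
    exact Finset.mem_image.2 ⟨V, Finset.mem_univ _, hV⟩
  obtain ⟨C, -, hC⟩ := Finset.subset_image_iff.1 hmem
  refine ⟨⟨C, (memL_image_joinMap he hd).1 (hC ▸ S.mem)⟩, L.val_injective hC⟩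

theorem joinEmb_top (he : ∀ i, e i ∉ X) (hd : d' + X.card = d) (hX : X.card ≤ d) :
    joinEmb he hd (Ltop m d') = singL n d X hX :=
  L.val_injective (by simp [val_joinEmb, Ltop, singL, joinMap])

end JoinMap

/-- For `T = {T_1,…,T_l} ∈ L(n,d)` with `l ≥ 1`,
`μ_{n,d}(T) = ∏_{i=1}^l μ_{n−|T_i|, d−|T_i|}(⊤)`, where `⊤ = {∅}` is the maximum
element of `L(n−|T_i|, d−|T_i|)` and `μ` denotes the Möbius function of each of
the posets (characterized by `μ(T,T) = 1` and `Σ_{S : T ≤ S ≤ T'} μ(T,S) = 0`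
for `T < T'`), with `μ_{n,d}(T) = μ_{n,d}(∅, T)`. -/
theorem mobius_eq_prod (n d : ℕ) (hnd : d < n) (T : L n d) (hT : T.val.Nonempty)
    (μ : (n' d' : ℕ) → L n' d' → L n' d' → ℤ)
    (hrefl : ∀ n' d' (A : L n' d'), μ n' d' A A = 1)
    (hrec : ∀ n' d' (A B : L n' d'), A < B →
      ∑ S ∈ Finset.univ.filter (fun S : L n' d' => A ≤ S ∧ S ≤ B), μ n' d' A S = 0) :
    μ n d (Lbot n d) T =
      ∏ X ∈ T.val,
        μ (n - X.card) (d - X.card)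
          (Lbot (n - X.card) (d - X.card)) (Ltop (n - X.card) (d - X.card)) := by
  refine mobius_eq_prod_singL (μ n d) (hrefl n d) (hrec n d) _ (fun X hX => ?_) T
  have hcard : Fintype.card {x // x ∉ X} = n - X.card := by simp
  let e : Fin (n - X.card) ↪ Fin n :=
    (Fintype.equivFinOfCardEq hcard).symm.toEmbedding.trans (Function.Embedding.subtype _)
  have he : ∀ i, e i ∉ X := fun i => ((Fintype.equivFinOfCardEq hcard).symm i).2
  have he' : ∀ x, x ∉ X → x ∈ Set.range e := fun x hx =>
    ⟨Fintype.equivFinOfCardEq hcard ⟨x, hx⟩, by simp [e]⟩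
  have hd : d - X.card + X.card = d := Nat.sub_add_cancel hX
  rw [← joinEmb_top he hd hX]
  exact (mobius_map_eq (μ n d) (μ _ _) (hrefl n d) (hrefl _ _) (hrec n d) (hrec _ _)
    (joinEmb he hd) (isLowerSet_range_joinEmb he he' hd) _).symm
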